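/- Let C be a nontrivial linear [n,k,d]_q code. Then C is completely regular with covering radius ρ = 2 and its dual code C⊥ is antipodal if and only if C is monomially equivalent to a code C₀ ⊆ 𝔽_q^n whose dual C₀⊥ is spanned by the all-one vector together with a linear subcode E ⊆ 𝔽_q^n which is equidistant with minimum distance d̃ and has the property that for every nonzero codeword v ∈ E and every symbol α ∈ 𝔽_q, the number of coordinates of v equal to α is either exactly n − d̃ or zero. Moreover, in this case C is monomially equivalent to the extended code of a completely regular code with covering radius 1. -/

import Mathlib

open Finset

variable {F : Type*} [Field F] [Fintype F] [DecidableEq F]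

/-- The Hamming distance from a vector to a code. -/
noncomputable def distToCode {ι : Type*} [Fintype ι] (C : Set (ι → F)) (x : ι → F) : ℕ :=
  sInf {d : ℕ | ∃ c ∈ C, hammingDist x c = d}

/-- The covering radius of a code: the maximal distance of a vector to the code. -/
noncomputable def coveringRadius {ι : Type*} [Fintype ι] (C : Set (ι → F)) : ℕ :=
  sSup {d : ℕ | ∃ x : ι → F, distToCode C x = d}

/-- `C` has intersection numbers `b l` (number of neighbours one step further from the code)
and `c l` (number of neighbours one step closer to the code), for every `x` at distance `l`. -/
def HasIntersectionNumbers {ι : Type*} [Fintype ι] (C : Set (ι → F)) (b c : ℕ → ℕ) : Prop :=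
  ∀ l : ℕ, ∀ x : ι → F, distToCode C x = l →
    Nat.card {y : ι → F | hammingDist x y = 1 ∧ distToCode C y = l + 1} = b l ∧
    Nat.card {y : ι → F | hammingDist x y = 1 ∧ distToCode C y + 1 = l} = c l

/-- A code is completely regular if it admits intersection numbers. -/
def IsCompletelyRegular {ι : Type*} [Fintype ι] (C : Set (ι → F)) : Prop :=
  ∃ b c : ℕ → ℕ, HasIntersectionNumbers C b c

/-- The minimum distance of a code. -/
noncomputable def minDist {ι : Type*} [Fintype ι] (C : Set (ι → F)) : ℕ :=
  sInf {d : ℕ | ∃ x ∈ C, ∃ y ∈ C, x ≠ y ∧ hammingDist x y = d}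

/-- A code is equidistant if any two distinct codewords are at the same Hamming distance. -/
def IsEquidistant {ι : Type*} [Fintype ι] (C : Set (ι → F)) : Prop :=
  ∃ d : ℕ, ∀ x ∈ C, ∀ y ∈ C, x ≠ y → hammingDist x y = d

/-- The dual of a code, with respect to the standard bilinear form. -/
def dualSet {ι : Type*} [Fintype ι] (C : Set (ι → F)) : Set (ι → F) :=
  {y | ∀ x ∈ C, ∑ i, x i * y i = 0}

/-- A code of length `n` is antipodal if it contains a word of Hamming weight `n`. -/
def IsAntipodal {ι : Type*} [Fintype ι] (C : Set (ι → F)) : Prop :=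
  ∃ v ∈ C, hammingNorm v = Fintype.card ι

/-- A monomial transformation: a coordinate permutation composed with multiplication of
each coordinate by a nonzero scalar. -/
def IsMonomialMap {ι : Type*} (φ : (ι → F) → (ι → F)) : Prop :=
  ∃ (π : Equiv.Perm ι) (s : ι → Fˣ), ∀ x i, φ x i = (s i : F) * x (π i)

/-- Two codes are monomially equivalent if one is the image of the other under a bijection of
coordinates together with multiplication of each coordinate by a nonzero scalar. -/
def MonomiallyEquivalent {ι κ : Type*} (C : Set (ι → F)) (D : Set (κ → F)) : Prop :=
  ∃ (e : ι ≃ κ) (s : ι → Fˣ),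
    (fun (x : ι → F) (j : κ) => (s (e.symm j) : F) * x (e.symm j)) '' C = D

/-- The orbit, under the action of `Aut C` on the cosets of `C`, of the coset of `v`
(realised as the union of all cosets in the orbit). -/
def cosetOrbit {ι : Type*} (C : Submodule F (ι → F)) (v : ι → F) : Set (ι → F) :=
  {w | ∃ φ : (ι → F) → (ι → F), IsMonomialMap φ ∧
    φ '' (C : Set (ι → F)) = (C : Set (ι → F)) ∧ φ v - w ∈ C}

/-- The number of orbits of the action of `Aut C` on the cosets of `C`. -/
noncomputable def numCosetOrbits {ι : Type*} (C : Submodule F (ι → F)) : ℕ :=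
  Nat.card (Set.range (cosetOrbit C))

/-- `H` is a `q`-ary Hamming code with parameter `m ≥ 2`: a perfect
`[(q^m-1)/(q-1), (q^m-1)/(q-1) - m, 3]_q` code with covering radius 1. -/
def IsHammingCode (m : ℕ) {nm : ℕ} (H : Submodule F (Fin nm → F)) : Prop :=
  2 ≤ m ∧ nm = (Fintype.card F ^ m - 1) / (Fintype.card F - 1) ∧
  Module.finrank F H = nm - m ∧ minDist (H : Set (Fin nm → F)) = 3 ∧
  coveringRadius (H : Set (Fin nm → F)) = 1

/-- The extended code: append an overall parity-check coordinate. -/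
def extendedCode {m : ℕ} (D : Set (Fin m → F)) : Set (Fin (m + 1) → F) :=
  {z | (fun i : Fin m => z i.castSucc) ∈ D ∧ ∑ i, z i = 0}

/-- Construction I(u): append `u` free coordinates to every codeword. -/
def appendCode (u : ℕ) {n : ℕ} (C : Set (Fin n → F)) : Set (Fin (n + u) → F) :=
  {z | ∃ c ∈ C, ∃ y : Fin u → F, z = Fin.append c y}

/-- Construction II(ℓ): codewords are `ℓ`-tuples of blocks whose `λ`-weighted sum lies in `C`. -/
def repeatCode {n ℓ : ℕ} (lam : Fin ℓ → Fˣ) (C : Set (Fin n → F)) :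
    Set (Fin ℓ × Fin n → F) :=
  {z | (fun j : Fin n => ∑ i : Fin ℓ, (lam i : F) * z (i, j)) ∈ C}

/-- The code `{(x₁|⋯|x_ℓ|y) : x₁+⋯+x_ℓ ∈ H, y free}` built from a code `H`. -/
def hammingRepeatCode {nm : ℕ} (ℓ u : ℕ) (H : Set (Fin nm → F)) :
    Set ((Fin ℓ × Fin nm) ⊕ Fin u → F) :=
  {z | (fun j : Fin nm => ∑ i : Fin ℓ, z (Sum.inl (i, j))) ∈ H}

set_option linter.unusedSectionVars false

/-- The words at Hamming distance one from `x` that lie at distance `j` from `C`. -/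
noncomputable def neighborsAt {ι : Type*} [Fintype ι] [DecidableEq ι] (C : Set (ι → F))
    (x : ι → F) (j : ℕ) : Finset (ι → F) :=
  univ.filter fun z => hammingDist x z = 1 ∧ distToCode C z = j

/-- The sum of the values at `t` of the nontrivial additive characters of `F`: `|F| - 1` at zero
and `-1` elsewhere. -/
def charSum (t : F) : ℤ := if t = 0 then (Fintype.card F : ℤ) - 1 else -1

/-- The eigenvalue of the Hamming graph attached to the frequency `y`. -/
def hammingEigenvalue {ι : Type*} [Fintype ι] (y : ι → F) : ℤ := ∑ i, charSum (y i)

/-- The words of the dual code, as a finite set. -/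
noncomputable def dualWords {ι : Type*} [Fintype ι] (C : Submodule F (ι → F)) :
    Finset (ι → F) :=
  (Set.toFinite (dualSet (C : Set (ι → F)))).toFinset

section Distance

variable {ι : Type*} [Fintype ι]

lemma distToCode_le {C : Set (ι → F)} {x c : ι → F} (hc : c ∈ C) :
    distToCode C x ≤ hammingDist x c :=
  Nat.sInf_le ⟨c, hc, rfl⟩

lemma exists_hammingDist_eq_distToCode (C : Submodule F (ι → F)) (x : ι → F) :
    ∃ c ∈ C, hammingDist x c = distToCode (C : Set (ι → F)) x :=
  Nat.sInf_mem (s := {d : ℕ | ∃ c ∈ (C : Set (ι → F)), hammingDist x c = d})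
    ⟨_, 0, C.zero_mem, rfl⟩

lemma distToCode_eq_zero_iff (C : Submodule F (ι → F)) (x : ι → F) :
    distToCode (C : Set (ι → F)) x = 0 ↔ x ∈ C := by
  constructor
  · intro h
    obtain ⟨c, hc, hd⟩ := exists_hammingDist_eq_distToCode C x
    rw [h, hammingDist_eq_zero] at hd
    rwa [hd]
  · intro h
    simpa using distToCode_le (x := x) (C := (C : Set (ι → F))) h

lemma distToCode_le_add (C : Submodule F (ι → F)) (x z : ι → F) :
    distToCode (C : Set (ι → F)) x ≤ hammingDist x z + distToCode (C : Set (ι → F)) z := by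
  obtain ⟨c, hc, hd⟩ := exists_hammingDist_eq_distToCode C z
  rw [← hd]
  exact (distToCode_le hc).trans (hammingDist_triangle x z c)

lemma distToCode_le_coveringRadius (C : Submodule F (ι → F)) (x : ι → F) :
    distToCode (C : Set (ι → F)) x ≤ coveringRadius (C : Set (ι → F)) := by
  classical
  exact le_csSup (Set.finite_range (distToCode (C : Set (ι → F)))).bddAbove ⟨x, rfl⟩

lemma coveringRadius_eq {C : Set (ι → F)} {r : ℕ} (hle : ∀ x, distToCode C x ≤ r)
    (hex : ∃ x, distToCode C x = r) : coveringRadius C = r :=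
  IsGreatest.csSup_eq ⟨hex, by rintro _ ⟨x, rfl⟩; exact hle x⟩

variable [DecidableEq ι]

@[simp]
lemma mem_neighborsAt {C : Set (ι → F)} {x z : ι → F} {j : ℕ} :
    z ∈ neighborsAt C x j ↔ hammingDist x z = 1 ∧ distToCode C z = j := by
  simp [neighborsAt]

lemma natCard_eq_card_neighborsAt (C : Set (ι → F)) (x : ι → F) (j : ℕ) :
    Nat.card {z : ι → F | hammingDist x z = 1 ∧ distToCode C z = j} =
      (neighborsAt C x j).card := by
  rw [Nat.card_coe_set_eq, ← Set.ncard_coe_finset]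
  congr 1
  ext z
  simp

lemma isCompletelyRegular_of_card_neighborsAt {C : Set (ι → F)}
    (h : ∀ x x' : ι → F, distToCode C x = distToCode C x' →
      ∀ j, (neighborsAt C x j).card = (neighborsAt C x' j).card) :
    IsCompletelyRegular C := by
  classical
  let m : ℕ → ℕ → ℕ := fun l j =>
    if hl : ∃ x, distToCode C x = l then (neighborsAt C hl.choose j).card else 0
  have hm : ∀ x j, (neighborsAt C x j).card = m (distToCode C x) j := by
    intro x j
    have hl : ∃ x', distToCode C x' = distToCode C x := ⟨x, rfl⟩
    simp only [m, dif_pos hl]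
    exact h _ _ hl.choose_spec.symm j
  refine ⟨fun l => m l (l + 1), fun l => if l = 0 then 0 else m l (l - 1), ?_⟩
  rintro l x rfl
  refine ⟨by rw [natCard_eq_card_neighborsAt, hm], ?_⟩
  beta_reduce
  split_ifs with h0
  · simp [h0]
  · rw [← hm, ← natCard_eq_card_neighborsAt]
    congr! 4
    omega

lemma card_neighborsAt_of_hasIntersectionNumbers {C : Set (ι → F)} {b c : ℕ → ℕ}
    (h : HasIntersectionNumbers C b c) (x : ι → F) :
    (neighborsAt C x (distToCode C x + 1)).card = b (distToCode C x) ∧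
      ∀ l, distToCode C x = l + 1 → (neighborsAt C x l).card = c (l + 1) := by
  refine ⟨?_, fun l hl => ?_⟩
  · rw [← natCard_eq_card_neighborsAt]
    exact (h _ x rfl).1
  · rw [← natCard_eq_card_neighborsAt, ← (h _ x hl).2]
    congr! 4
    omega

lemma exists_eq_add_single_of_hammingDist_eq_one {x z : ι → F} (h : hammingDist x z = 1) :
    ∃ i, ∃ t : F, t ≠ 0 ∧ z = x + Pi.single i t := by
  rw [hammingDist, Finset.card_eq_one] at h
  obtain ⟨i, hi⟩ := h
  have hmem : ∀ j, x j ≠ z j ↔ j = i := fun j => by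
    simpa using congrArg (j ∈ ·) hi
  refine ⟨i, z i - x i, sub_ne_zero.2 ((hmem i).2 rfl).symm, funext fun j => ?_⟩
  by_cases hj : j = i
  · subst hj; simp
  · have := not_not.1 (mt (hmem j).1 hj)
    simp [hj, this]

lemma hammingDist_add_single (x : ι → F) (i : ι) {t : F} (ht : t ≠ 0) :
    hammingDist x (x + Pi.single i t) = 1 := by
  rw [hammingDist, Finset.card_eq_one]
  refine ⟨i, Finset.ext fun j => ?_⟩
  by_cases hj : j = i
  · subst hj; simp [ht]
  · simp [hj]

lemma sum_neighbors {M : Type*} [AddCommMonoid M] (x : ι → F) (f : (ι → F) → M) :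
    ∑ z with hammingDist x z = 1, f z =
      ∑ i, ∑ t ∈ univ.erase (0 : F), f (x + Pi.single i t) := by
  rw [← Finset.sum_product']
  symm
  refine Finset.sum_bij (fun p _ => x + Pi.single p.1 p.2) ?_ ?_ ?_ fun _ _ => rfl
  · rintro ⟨i, t⟩ h
    have ht : t ≠ 0 := by simpa using h
    simpa using hammingDist_add_single x i ht
  · rintro ⟨i, t⟩ h ⟨i', t'⟩ h' he
    have ht : t ≠ 0 := by simpa using h
    have he' := congrFun (add_left_cancel he) i
    have hii : i = i' := by
      by_contra hne
      simp [hne, ht] at he'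
    subst hii
    simpa using he'
  · intro z hz
    obtain ⟨i, t, ht, rfl⟩ := exists_eq_add_single_of_hammingDist_eq_one (by simpa using hz)
    exact ⟨(i, t), by simpa using ht, rfl⟩

lemma sum_charSum : ∑ t : F, charSum t = 0 := by
  have : ∀ t : F, charSum t = (if t = 0 then (Fintype.card F : ℤ) else 0) - 1 := fun t => by
    unfold charSum; split_ifs <;> simp
  simp [this]

lemma sum_charSum_affine (a : F) {b : F} (hb : b ≠ 0) :
    ∑ t : F, charSum (a + t * b) = 0 := by
  rw [← sum_charSum (F := F)]
  exact Fintype.sum_equiv ((Equiv.mulRight₀ b hb).trans (Equiv.addLeft a)) _ _ fun t => rfl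

lemma sum_erase_charSum_affine (a b : F) :
    ∑ t ∈ univ.erase (0 : F), charSum (a + t * b) = charSum b * charSum a := by
  by_cases hb : b = 0
  · subst hb
    have := Fintype.card_pos (α := F)
    simp only [mul_zero, add_zero, sum_const, card_erase_of_mem (mem_univ _), card_univ,
      nsmul_eq_mul, Nat.cast_sub (Nat.succ_le_of_lt this)]
    simp [charSum]
  · rw [← add_right_inj (charSum (a + 0 * b)),
      Finset.add_sum_erase univ (fun t => charSum (a + t * b)) (mem_univ _),
      sum_charSum_affine a hb]
    simp only [charSum, hb, if_false, zero_mul, add_zero]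
    ring

lemma sum_neighbors_charSum (x y : ι → F) :
    ∑ z with hammingDist x z = 1, charSum (z ⬝ᵥ y) =
      hammingEigenvalue y * charSum (x ⬝ᵥ y) := by
  rw [sum_neighbors, hammingEigenvalue, Finset.sum_mul]
  refine Finset.sum_congr rfl fun i _ => ?_
  simp_rw [add_dotProduct, single_dotProduct]
  exact sum_erase_charSum_affine _ _

omit [DecidableEq ι] in
lemma hammingEigenvalue_eq (y : ι → F) :
    hammingEigenvalue y = Fintype.card ι * ((Fintype.card F : ℤ) - 1) -
      Fintype.card F * hammingNorm y := by
  have : ∀ t : F, charSum t =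
      ((Fintype.card F : ℤ) - 1) - Fintype.card F * (if t ≠ 0 then 1 else 0) := fun t => by
    unfold charSum; split_ifs <;> simp_all
  simp only [hammingEigenvalue, this, Finset.sum_sub_distrib, ← Finset.mul_sum, Finset.sum_boole,
    hammingNorm]
  simp [mul_sub]

omit [DecidableEq ι] in
lemma hammingEigenvalue_injOn {y y' : ι → F}
    (h : hammingEigenvalue y = hammingEigenvalue y') : hammingNorm y = hammingNorm y' := by
  rw [hammingEigenvalue_eq, hammingEigenvalue_eq, sub_right_inj] at h
  have hq : (Fintype.card F : ℤ) ≠ 0 := by exact_mod_cast Fintype.card_ne_zero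
  exact_mod_cast mul_left_cancel₀ hq h

end Distance

section Dual

variable {ι : Type*} [Fintype ι]

@[simp]
lemma mem_dualWords {C : Submodule F (ι → F)} {y : ι → F} :
    y ∈ dualWords C ↔ ∀ x ∈ C, x ⬝ᵥ y = 0 := by
  simp [dualWords, dualSet, dotProduct]

lemma exists_mem_dualWords_of_notMem {C : Submodule F (ι → F)} {x : ι → F} (hx : x ∉ C) :
    ∃ y ∈ dualWords C, x ⬝ᵥ y ≠ 0 := by
  classical
  obtain ⟨f, hfx, hf⟩ := Submodule.exists_dual_map_eq_bot_of_notMem hx inferInstance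
  have hfe : ∀ z, z ⬝ᵥ (fun i => f (Pi.single i 1)) = f z := fun z => by
    rw [LinearMap.pi_apply_eq_sum_univ f z]
    simp only [dotProduct, smul_eq_mul]
    refine Finset.sum_congr rfl fun i _ => ?_
    congr 2
    ext j
    simp [Pi.single_apply, eq_comm]
  refine ⟨fun i => f (Pi.single i 1), ?_, by rwa [hfe]⟩
  rw [mem_dualWords]
  intro z hz
  rw [hfe]
  have hfz : f z ∈ C.map f := Submodule.mem_map_of_mem hz
  rwa [hf, Submodule.mem_bot] at hfz

lemma exists_dual_word_apply_eq_zero {C : Submodule F (ι → F)}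
    (hC : Module.finrank F C + 2 ≤ Fintype.card ι) (j : ι) :
    ∃ y ∈ dualWords C, y ≠ 0 ∧ y j = 0 := by
  classical
  have hlt : C ⊔ Submodule.span F {Pi.single j (1 : F)} ≠ ⊤ := by
    intro htop
    have h1 := Submodule.finrank_add_le_finrank_add_finrank C
      (Submodule.span F {(Pi.single j (1 : F) : ι → F)})
    have h2 := finrank_span_le_card (R := F) ({(Pi.single j (1 : F) : ι → F)} : Set (ι → F))
    rw [htop, finrank_top, Module.finrank_fintype_fun_eq_card] at h1
    simp at h2
    omega
  obtain ⟨x, hx⟩ : ∃ x, x ∉ C ⊔ Submodule.span F {Pi.single j (1 : F)} := by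
    by_contra! h
    exact hlt (Submodule.eq_top_iff'.2 h)
  obtain ⟨y, hy, hxy⟩ := exists_mem_dualWords_of_notMem hx
  rw [mem_dualWords] at hy
  refine ⟨y, mem_dualWords.2 fun z hz => hy z (Submodule.mem_sup_left hz), ?_, ?_⟩
  · rintro rfl
    simp at hxy
  · simpa using hy _ (Submodule.mem_sup_right (Submodule.mem_span_singleton_self _))

lemma add_mem_dualWords {C : Submodule F (ι → F)} {y z : ι → F} (hy : y ∈ dualWords C)
    (hz : z ∈ dualWords C) : y + z ∈ dualWords C := by
  rw [mem_dualWords] at *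
  intro x hx
  rw [dotProduct_add, hy x hx, hz x hx, add_zero]

lemma smul_mem_dualWords {C : Submodule F (ι → F)} {y : ι → F} (a : F) (hy : y ∈ dualWords C) :
    a • y ∈ dualWords C := by
  rw [mem_dualWords] at *
  intro x hx
  rw [dotProduct_smul, hy x hx, smul_zero]

lemma zero_mem_dualWords (C : Submodule F (ι → F)) : 0 ∈ dualWords C := by
  simp

lemma sum_dualWords_charSum (C : Submodule F (ι → F)) (x : ι → F) :
    ∑ y ∈ dualWords C, charSum (x ⬝ᵥ y) =
      (dualWords C).card * ((Fintype.card F : ℤ) - 1) *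
        if distToCode (C : Set (ι → F)) x = 0 then 1 else 0 := by
  split_ifs with h
  · rw [distToCode_eq_zero_iff] at h
    rw [Finset.sum_congr rfl fun y hy => by rw [mem_dualWords.1 hy x h]]
    simp [charSum, mul_sub]
  · rw [distToCode_eq_zero_iff] at h
    obtain ⟨y₀, hy₀, hne⟩ := exists_mem_dualWords_of_notMem h
    have hshift : ∀ t : F, ∑ y ∈ dualWords C, charSum (x ⬝ᵥ y + t * (x ⬝ᵥ y₀)) =
        ∑ y ∈ dualWords C, charSum (x ⬝ᵥ y) := by
      intro t
      refine Finset.sum_bij' (fun y _ => y + t • y₀) (fun y _ => y + (-t) • y₀) ?_ ?_ ?_ ?_ ?_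
      · exact fun y hy => add_mem_dualWords hy (smul_mem_dualWords _ hy₀)
      · exact fun y hy => add_mem_dualWords hy (smul_mem_dualWords _ hy₀)
      · intro y _; simp
      · intro y _; simp
      · intro y _; simp
    have hq : (Fintype.card F : ℤ) ≠ 0 := by exact_mod_cast Fintype.card_ne_zero
    have hsum : (Fintype.card F : ℤ) * ∑ y ∈ dualWords C, charSum (x ⬝ᵥ y) = 0 := by
      calc (Fintype.card F : ℤ) * ∑ y ∈ dualWords C, charSum (x ⬝ᵥ y)
          = ∑ t : F, ∑ y ∈ dualWords C, charSum (x ⬝ᵥ y + t * (x ⬝ᵥ y₀)) := by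
            simp [hshift]
        _ = 0 := by
            rw [Finset.sum_comm]
            exact Finset.sum_eq_zero fun y _ => sum_charSum_affine _ hne
    simpa [hq] using hsum

end Dual

section Spectrum

variable {ι : Type*} [Fintype ι] [DecidableEq ι]

lemma card_neighborsAt_eq_sum (C : Set (ι → F)) (x : ι → F) (j : ℕ) :
    ((neighborsAt C x j).card : ℤ) =
      ∑ z with hammingDist x z = 1, if distToCode C z = j then 1 else 0 := by
  rw [neighborsAt, ← Finset.filter_filter, Finset.card_filter]
  push_cast
  rfl

lemma card_neighbors (x : ι → F) :
    ((univ.filter fun z : ι → F => hammingDist x z = 1).card : ℤ) =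
      Fintype.card ι * ((Fintype.card F : ℤ) - 1) := by
  have h := sum_neighbors x fun _ : ι → F => (1 : ℤ)
  have hq := Fintype.card_pos (α := F)
  simp only [sum_const, card_erase_of_mem (mem_univ (0 : F)), card_univ, nsmul_eq_mul, mul_one,
    Nat.cast_sub (Nat.succ_le_of_lt hq)] at h
  simpa using h

lemma distToCode_close {C : Submodule F (ι → F)} {x z : ι → F} (h : hammingDist x z = 1) :
    distToCode (C : Set (ι → F)) x ≤ distToCode (C : Set (ι → F)) z + 1 ∧
      distToCode (C : Set (ι → F)) z ≤ distToCode (C : Set (ι → F)) x + 1 := by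
  have h1 := distToCode_le_add C x z
  have h2 := distToCode_le_add C z x
  rw [hammingDist_comm] at h2
  omega

lemma card_neighborsAt_eq_zero {C : Submodule F (ι → F)} {x : ι → F} {j : ℕ}
    (h : j + 1 < distToCode (C : Set (ι → F)) x ∨ distToCode (C : Set (ι → F)) x + 1 < j) :
    (neighborsAt (C : Set (ι → F)) x j).card = 0 := by
  rw [Finset.card_eq_zero, Finset.eq_empty_iff_forall_notMem]
  intro z hz
  obtain ⟨hxz, rfl⟩ := mem_neighborsAt.1 hz
  have := distToCode_close (C := C) hxz
  omega

lemma card_neighborsAt_eq_zero_of_lt {C : Set (ι → F)} {r j : ℕ}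
    (hC : ∀ x, distToCode C x ≤ r) (hj : r < j) (x : ι → F) :
    (neighborsAt C x j).card = 0 := by
  rw [Finset.card_eq_zero, Finset.eq_empty_iff_forall_notMem]
  intro z hz
  have := hC z
  have := (mem_neighborsAt.1 hz).2
  omega

lemma sum_card_neighborsAt {C : Submodule F (ι → F)} {r : ℕ}
    (hC : ∀ x, distToCode (C : Set (ι → F)) x ≤ r) (x : ι → F) :
    ∑ j ∈ Finset.range (r + 1), ((neighborsAt (C : Set (ι → F)) x j).card : ℤ) =
      Fintype.card ι * ((Fintype.card F : ℤ) - 1) := by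
  rw [← card_neighbors x, Finset.card_eq_sum_card_fiberwise (t := Finset.range (r + 1))
    (f := distToCode (C : Set (ι → F))) fun z _ => by simpa [Nat.lt_succ_iff] using hC z]
  push_cast
  simp only [neighborsAt, Finset.filter_filter]

lemma card_neighborsAt_zero (C : Submodule F (ι → F)) (x : ι → F) :
    (dualWords C).card * ((Fintype.card F : ℤ) - 1) *
        (neighborsAt (C : Set (ι → F)) x 0).card =
      ∑ y ∈ dualWords C, hammingEigenvalue y * charSum (x ⬝ᵥ y) := by
  rw [card_neighborsAt_eq_sum, Finset.mul_sum]
  simp_rw [← sum_dualWords_charSum, ← sum_neighbors_charSum]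
  rw [Finset.sum_comm]

lemma sum_neighbors_card_neighborsAt_zero (C : Submodule F (ι → F)) (x : ι → F) :
    ∑ z with hammingDist x z = 1, (dualWords C).card * ((Fintype.card F : ℤ) - 1) *
        (neighborsAt (C : Set (ι → F)) z 0).card =
      ∑ y ∈ dualWords C, hammingEigenvalue y ^ 2 * charSum (x ⬝ᵥ y) := by
  simp_rw [card_neighborsAt_zero]
  rw [Finset.sum_comm]
  refine Finset.sum_congr rfl fun y _ => ?_
  rw [← Finset.mul_sum, sum_neighbors_charSum]
  ring

lemma sum_univ_charSum {y : ι → F} (hy : y ≠ 0) :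
    ∑ x : ι → F, charSum (x ⬝ᵥ y) = 0 := by
  have h := sum_dualWords_charSum (⊥ : Submodule F (ι → F)) y
  rw [if_neg (by rw [distToCode_eq_zero_iff]; simpa using hy), mul_zero] at h
  rw [← h]
  refine Finset.sum_congr (by ext; simp) fun x _ => by rw [dotProduct_comm]

lemma hammingEigenvalue_mul_sum (C : Set (ι → F)) (y : ι → F) (j : ℕ) :
    hammingEigenvalue y * ∑ x with distToCode C x = j, charSum (x ⬝ᵥ y) =
      ∑ x, charSum (x ⬝ᵥ y) * (neighborsAt C x j).card := by
  rw [Finset.mul_sum]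
  simp_rw [← sum_neighbors_charSum, card_neighborsAt_eq_sum, Finset.mul_sum, Finset.sum_filter]
  conv_rhs => rw [Finset.sum_comm]
  refine Finset.sum_congr rfl fun x _ => ?_
  split_ifs <;> simp [hammingDist_comm]

/-- The eigenvalues attached to nonzero dual words of a completely regular code with covering
radius two are roots of one monic quadratic polynomial. -/
lemma exists_quadratic_of_isCompletelyRegular {C : Submodule F (ι → F)}
    (hC : IsCompletelyRegular (C : Set (ι → F)))
    (hr : coveringRadius (C : Set (ι → F)) = 2) :
    ∃ p r : ℤ, ∀ y ∈ dualWords C, y ≠ 0 →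
      hammingEigenvalue y ^ 2 + p * hammingEigenvalue y + r = 0 := by
  obtain ⟨b, c, hbc⟩ := hC
  have hle : ∀ x, distToCode (C : Set (ι → F)) x ≤ 2 := fun x =>
    hr ▸ distToCode_le_coveringRadius C x
  set N : ℤ := Fintype.card ι * ((Fintype.card F : ℤ) - 1) with hN
  have hsum : ∀ x, ((neighborsAt (C : Set (ι → F)) x 0).card : ℤ) +
      (neighborsAt (C : Set (ι → F)) x 1).card +
      (neighborsAt (C : Set (ι → F)) x 2).card = N := fun x => by
    simpa [Finset.sum_range_succ] using sum_card_neighborsAt hle x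
  have hb := fun x => (card_neighborsAt_of_hasIntersectionNumbers hbc x).1
  have hc := fun x => (card_neighborsAt_of_hasIntersectionNumbers hbc x).2
  have h0 : ∀ x, ((neighborsAt (C : Set (ι → F)) x 0).card : ℤ) =
      (if distToCode (C : Set (ι → F)) x = 0 then 1 else 0) * (N - b 0) +
      (if distToCode (C : Set (ι → F)) x = 1 then 1 else 0) * c 1 := by
    intro x
    have hx := hle x
    have hs := hsum x
    have hbx := hb x
    have hcx := hc x
    interval_cases hd : distToCode (C : Set (ι → F)) x
    · have h2 := card_neighborsAt_eq_zero (C := C) (x := x) (j := 2) (by omega)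
      rw [h2, hbx] at hs
      simp; push_cast at hs; linarith
    · simp [hcx 0 rfl]
    · simp [card_neighborsAt_eq_zero (C := C) (x := x) (j := 0) (by omega)]
  have h1 : ∀ x, ((neighborsAt (C : Set (ι → F)) x 1).card : ℤ) =
      (if distToCode (C : Set (ι → F)) x = 0 then 1 else 0) * b 0 +
      (if distToCode (C : Set (ι → F)) x = 1 then 1 else 0) * (N - b 1 - c 1) +
      (if distToCode (C : Set (ι → F)) x = 2 then 1 else 0) * c 2 := by
    intro x
    have hx := hle x
    have hs := hsum x
    have hbx := hb x
    have hcx := hc x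
    interval_cases hd : distToCode (C : Set (ι → F)) x
    · simpa using hbx
    · rw [hcx 0 rfl, hbx] at hs
      simp; linarith
    · simp [hcx 1 rfl]
  refine ⟨-(N - b 0) - (N - b 1 - c 1) + c 2,
    (N - b 0) * (N - b 1 - c 1 - c 2) - c 1 * (b 0 - c 2), fun y hy hy0 => ?_⟩
  set G : ℕ → ℤ := fun j =>
    ∑ x with distToCode (C : Set (ι → F)) x = j, charSum (x ⬝ᵥ y) with hG
  have hGsum : ∀ j, G j = ∑ x, charSum (x ⬝ᵥ y) *
      if distToCode (C : Set (ι → F)) x = j then 1 else 0 := fun j => by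
    simp [hG, Finset.sum_filter]
  have htot : G 0 + G 1 + G 2 = 0 := by
    rw [hGsum, hGsum, hGsum, ← Finset.sum_add_distrib, ← Finset.sum_add_distrib]
    refine Eq.trans ?_ (sum_univ_charSum hy0)
    refine Finset.sum_congr rfl fun x _ => ?_
    have hx := hle x
    interval_cases distToCode (C : Set (ι → F)) x <;> simp
  have e0 : hammingEigenvalue y * G 0 = (N - b 0) * G 0 + c 1 * G 1 := by
    rw [hG, hammingEigenvalue_mul_sum, ← hG, hGsum, hGsum, Finset.mul_sum, Finset.mul_sum,
      ← Finset.sum_add_distrib]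
    exact Finset.sum_congr rfl fun x _ => by rw [h0]; ring
  have e1 : hammingEigenvalue y * G 1 =
      b 0 * G 0 + (N - b 1 - c 1) * G 1 + c 2 * G 2 := by
    rw [hG, hammingEigenvalue_mul_sum, ← hG, hGsum, hGsum, hGsum, Finset.mul_sum, Finset.mul_sum,
      Finset.mul_sum, ← Finset.sum_add_distrib, ← Finset.sum_add_distrib]
    exact Finset.sum_congr rfl fun x _ => by rw [h1]; ring
  have hG0 : G 0 ≠ 0 := by
    have hval : ∀ x ∈ univ.filter fun x => distToCode (C : Set (ι → F)) x = 0,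
        charSum (x ⬝ᵥ y) = (Fintype.card F : ℤ) - 1 := by
      intro x hx
      rw [mem_filter, distToCode_eq_zero_iff] at hx
      rw [mem_dualWords.1 hy x hx.2, charSum, if_pos rfl]
    have hpos : 0 < (univ.filter fun x => distToCode (C : Set (ι → F)) x = 0).card :=
      Finset.card_pos.2 ⟨0, by simp [distToCode_eq_zero_iff]⟩
    have hq := Fintype.one_lt_card (α := F)
    rw [hG]
    dsimp only
    rw [Finset.sum_congr rfl hval, sum_const, nsmul_eq_mul]
    refine mul_ne_zero (by exact_mod_cast hpos.ne') ?_
    have : (1 : ℤ) < Fintype.card F := by exact_mod_cast hq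
    omega
  refine mul_right_cancel₀ hG0 ?_
  have hG2 : G 2 = -G 0 - G 1 := by linarith
  rw [hG2] at e1
  linear_combination (hammingEigenvalue y - (N - b 1 - c 1) + c 2) * e0 + (c 1 : ℤ) * e1

/-- A proper code all of whose nonzero dual words share one nonzero weight is completely regular
with covering radius one. -/
lemma isCompletelyRegular_of_one_weight {C : Submodule F (ι → F)} {w : ℕ} (hw : 0 < w)
    (hwt : ∀ y ∈ dualWords C, y ≠ 0 → hammingNorm y = w) (hne : ∃ x, x ∉ C) :
    IsCompletelyRegular (C : Set (ι → F)) ∧ coveringRadius (C : Set (ι → F)) = 1 := by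
  set K : ℤ := (dualWords C).card * ((Fintype.card F : ℤ) - 1) with hK
  set N : ℤ := Fintype.card ι * ((Fintype.card F : ℤ) - 1) with hN
  set θ : ℤ := N - Fintype.card F * w with hθ
  have hq : (1 : ℤ) < Fintype.card F := by exact_mod_cast Fintype.one_lt_card (α := F)
  have hKpos : 0 < K := mul_pos
    (by exact_mod_cast Finset.card_pos.2 ⟨0, zero_mem_dualWords C⟩) (by linarith)
  have hN0 : hammingEigenvalue (0 : ι → F) = N := by simp [hammingEigenvalue_eq, hN]
  have hNθ : 0 < N - θ := by
    rw [hθ, sub_sub_cancel]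
    exact mul_pos (by linarith) (by exact_mod_cast hw)
  have hT : ∀ x, K * (neighborsAt (C : Set (ι → F)) x 0).card =
      θ * (K * if distToCode (C : Set (ι → F)) x = 0 then 1 else 0) +
        (N - θ) * ((Fintype.card F : ℤ) - 1) := by
    intro x
    rw [card_neighborsAt_zero, hK, ← sum_dualWords_charSum, Finset.mul_sum, ← sub_eq_iff_eq_add',
      ← Finset.sum_sub_distrib, Finset.sum_eq_single 0]
    · simp [hN0, charSum]; ring
    · intro y hy hy0
      rw [hammingEigenvalue_eq, hwt y hy hy0, hθ, hN]
      ring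
    · exact fun h => absurd (zero_mem_dualWords C) h
  have hle : ∀ x, distToCode (C : Set (ι → F)) x ≤ 1 := by
    intro x
    by_contra! hx
    have h := hT x
    rw [card_neighborsAt_eq_zero (Or.inl (by omega)), if_neg (by omega)] at h
    have : 0 < (N - θ) * ((Fintype.card F : ℤ) - 1) := mul_pos hNθ (by linarith)
    simp at h
    rcases h with h | h <;> linarith
  obtain ⟨x₀, hx₀⟩ := hne
  refine ⟨isCompletelyRegular_of_card_neighborsAt fun x x' hxx' j => ?_,
    coveringRadius_eq hle ⟨x₀, ?_⟩⟩
  · have h0 : ((neighborsAt (C : Set (ι → F)) x 0).card : ℤ) =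
        (neighborsAt (C : Set (ι → F)) x' 0).card :=
      mul_left_cancel₀ hKpos.ne' (by rw [hT, hT, hxx'])
    have hs := sum_card_neighborsAt hle x
    have hs' := sum_card_neighborsAt hle x'
    simp only [Finset.sum_range_succ, Finset.sum_range_zero] at hs hs'
    rcases j with _ | _ | j
    · exact_mod_cast h0
    · zify; simp only [zero_add] at *; linarith
    · rw [card_neighborsAt_eq_zero_of_lt hle (by omega),
        card_neighborsAt_eq_zero_of_lt hle (by omega)]
  · have := hle x₀
    have h0 := mt (distToCode_eq_zero_iff C x₀).1 hx₀
    omega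

/-- A code with a dual word `v` of full weight, properly contained in `v⊥`, all of whose nonzero
dual words have full weight or one further nonzero weight, is completely regular with covering
radius two. -/
lemma isCompletelyRegular_of_two_weights {C : Submodule F (ι → F)} {w : ℕ} (hw : 0 < w)
    (hwt : ∀ y ∈ dualWords C, y ≠ 0 → hammingNorm y = Fintype.card ι ∨ hammingNorm y = w)
    {v : ι → F} (hv : v ∈ dualWords C) (hv0 : ∀ i, v i ≠ 0) (hne : ∃ x, x ∉ C ∧ x ⬝ᵥ v = 0) :
    IsCompletelyRegular (C : Set (ι → F)) ∧ coveringRadius (C : Set (ι → F)) = 2 := by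
  set K : ℤ := (dualWords C).card * ((Fintype.card F : ℤ) - 1) with hK
  set N : ℤ := Fintype.card ι * ((Fintype.card F : ℤ) - 1) with hN
  set θ₁ : ℤ := N - Fintype.card F * Fintype.card ι with hθ₁
  set θ₂ : ℤ := N - Fintype.card F * w with hθ₂
  have hq : (1 : ℤ) < Fintype.card F := by exact_mod_cast Fintype.one_lt_card (α := F)
  have hKpos : 0 < K := mul_pos
    (by exact_mod_cast Finset.card_pos.2 ⟨0, zero_mem_dualWords C⟩) (by linarith)
  have hN0 : hammingEigenvalue (0 : ι → F) = N := by simp [hammingEigenvalue_eq, hN]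
  obtain ⟨x₀, hx₀, hx₀v⟩ := hne
  have hadj : ∀ z i, ∀ t : F, t ≠ 0 → z ⬝ᵥ v = 0 → z + Pi.single i t ∉ C := by
    intro z i t ht hz hmem
    have := mem_dualWords.1 hv _ hmem
    rw [add_dotProduct, hz, single_dotProduct, zero_add] at this
    exact mul_ne_zero ht (hv0 i) this
  have hcard : 0 < Fintype.card ι := by
    by_contra! h
    have : IsEmpty ι := Fintype.card_eq_zero_iff.1 (by omega)
    exact hx₀ (by rw [Subsingleton.elim x₀ 0]; exact C.zero_mem)
  have hperp : ∀ x, x ⬝ᵥ v = 0 → (neighborsAt (C : Set (ι → F)) x 0).card = 0 := by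
    intro x hx
    rw [Finset.card_eq_zero, Finset.eq_empty_iff_forall_notMem]
    intro z hz
    obtain ⟨hxz, hz0⟩ := mem_neighborsAt.1 hz
    obtain ⟨i, t, ht, rfl⟩ := exists_eq_add_single_of_hammingDist_eq_one hxz
    exact hadj x i t ht hx ((distToCode_eq_zero_iff C _).1 hz0)
  set κ : ℤ := ∑ y ∈ dualWords C, (hammingEigenvalue y - θ₂) *
    (if y = 0 then (Fintype.card F : ℤ) - 1 else -1) with hκ
  have hone : ∀ x, distToCode (C : Set (ι → F)) x = 1 →
      K * (neighborsAt (C : Set (ι → F)) x 0).card = κ := by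
    intro x hx
    have hsum0 := sum_dualWords_charSum C x
    rw [if_neg (by omega), mul_zero] at hsum0
    obtain ⟨c, hc, hxc⟩ := exists_hammingDist_eq_distToCode C x
    rw [hx, hammingDist_comm] at hxc
    obtain ⟨i, t, ht, rfl⟩ := exists_eq_add_single_of_hammingDist_eq_one hxc
    rw [card_neighborsAt_zero, ← sub_zero (∑ y ∈ dualWords C, _), ← mul_zero θ₂, ← hsum0,
      Finset.mul_sum, ← Finset.sum_sub_distrib]
    refine Finset.sum_congr rfl fun y hy => ?_
    rw [← sub_mul]
    by_cases hy0 : y = 0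
    · simp [hy0, charSum]
    · rw [if_neg hy0]
      rcases hwt y hy hy0 with h | h
      · have hyi : y i ≠ 0 := by
          have : ∀ j, y j ≠ 0 := by
            simpa [hammingNorm] using Finset.card_eq_iff_eq_univ _ |>.1 h
          exact this i
        rw [add_dotProduct, mem_dualWords.1 hy c hc, single_dotProduct, zero_add, charSum,
          if_neg (mul_ne_zero ht hyi)]
      · rw [hammingEigenvalue_eq, h, ← hN, ← hθ₂, sub_self, zero_mul, zero_mul]
  have hT0 : ∀ x, K * (neighborsAt (C : Set (ι → F)) x 0).card =
      κ * if distToCode (C : Set (ι → F)) x = 1 then 1 else 0 := by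
    intro x
    rcases lt_trichotomy (distToCode (C : Set (ι → F)) x) 1 with h | h | h
    · rw [hperp x, if_neg h.ne]
      · simp
      · exact mem_dualWords.1 hv x ((distToCode_eq_zero_iff C x).1 (by omega))
    · rw [hone x h, if_pos h, mul_one]
    · rw [card_neighborsAt_eq_zero (Or.inl (by omega)), if_neg h.ne']
      simp
  set γ : ℤ := (N - θ₁) * (N - θ₂) * ((Fintype.card F : ℤ) - 1) with hγ
  have hγpos : 0 < γ := by
    rw [hγ, hθ₁, hθ₂, sub_sub_cancel, sub_sub_cancel]
    have : (0 : ℤ) < Fintype.card ι := by exact_mod_cast hcard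
    have : (0 : ℤ) < w := by exact_mod_cast hw
    have : (0 : ℤ) < Fintype.card F := by linarith
    have : (0 : ℤ) < (Fintype.card F : ℤ) - 1 := by linarith
    positivity
  have hT1 : ∀ x, κ * (neighborsAt (C : Set (ι → F)) x 1).card =
      (θ₁ + θ₂) * (κ * if distToCode (C : Set (ι → F)) x = 1 then 1 else 0) -
        θ₁ * θ₂ * (K * if distToCode (C : Set (ι → F)) x = 0 then 1 else 0) + γ := by
    intro x
    rw [card_neighborsAt_eq_sum, Finset.mul_sum]
    simp_rw [← hT0]
    rw [sum_neighbors_card_neighborsAt_zero, hK, ← sum_dualWords_charSum, card_neighborsAt_zero,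
      ← sub_eq_iff_eq_add', Finset.mul_sum, Finset.mul_sum, ← Finset.sum_sub_distrib,
      ← Finset.sum_sub_distrib, Finset.sum_eq_single 0]
    · rw [hN0, dotProduct_zero, charSum, if_pos rfl]; ring
    · intro y hy hy0
      rcases hwt y hy hy0 with h | h
      · rw [hammingEigenvalue_eq, h, ← hN, ← hθ₁]; ring
      · rw [hammingEigenvalue_eq, h, ← hN, ← hθ₂]; ring
    · exact fun h => absurd (zero_mem_dualWords C) h
  have hx₀2 : 2 ≤ distToCode (C : Set (ι → F)) x₀ := by
    have h0 := mt (distToCode_eq_zero_iff C x₀).1 hx₀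
    by_contra! h
    obtain ⟨c, hc, hxc⟩ := exists_hammingDist_eq_distToCode C x₀
    have h1 : c ∈ neighborsAt (C : Set (ι → F)) x₀ 0 :=
      mem_neighborsAt.2 ⟨by omega, (distToCode_eq_zero_iff C c).2 hc⟩
    rw [Finset.card_eq_zero.1 (hperp x₀ hx₀v)] at h1
    simp at h1
  have hfar : ∀ x, 2 ≤ distToCode (C : Set (ι → F)) x →
      κ * (neighborsAt (C : Set (ι → F)) x 1).card = γ := by
    intro x hx
    rw [hT1, if_neg (by omega), if_neg (by omega)]
    ring
  have hκ0 : κ ≠ 0 := by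
    intro h
    have := hfar x₀ hx₀2
    rw [h, zero_mul] at this
    omega
  have hle : ∀ x, distToCode (C : Set (ι → F)) x ≤ 2 := by
    intro x
    by_contra! hx
    have h := hfar x (by omega)
    rw [card_neighborsAt_eq_zero (Or.inl (by omega)), Nat.cast_zero, mul_zero] at h
    omega
  refine ⟨isCompletelyRegular_of_card_neighborsAt fun x x' hxx' j => ?_,
    coveringRadius_eq hle ⟨x₀, le_antisymm (hle x₀) hx₀2⟩⟩
  have h0 : ((neighborsAt (C : Set (ι → F)) x 0).card : ℤ) =
      (neighborsAt (C : Set (ι → F)) x' 0).card :=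
    mul_left_cancel₀ hKpos.ne' (by rw [hT0, hT0, hxx'])
  have h1 : ((neighborsAt (C : Set (ι → F)) x 1).card : ℤ) =
      (neighborsAt (C : Set (ι → F)) x' 1).card :=
    mul_left_cancel₀ hκ0 (by rw [hT1, hT1, hxx'])
  have hs := sum_card_neighborsAt hle x
  have hs' := sum_card_neighborsAt hle x'
  simp only [Finset.sum_range_succ, Finset.sum_range_zero] at hs hs'
  rcases j with _ | _ | _ | j
  · exact_mod_cast h0
  · exact_mod_cast h1
  · zify; simp only [zero_add, Nat.reduceAdd] at *; linarith
  · rw [card_neighborsAt_eq_zero_of_lt hle (by omega),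
      card_neighborsAt_eq_zero_of_lt hle (by omega)]

end Spectrum

section Weights

variable {ι : Type*} [Fintype ι]

lemma hammingNorm_eq_card_iff {y : ι → F} :
    hammingNorm y = Fintype.card ι ↔ ∀ i, y i ≠ 0 := by
  simpa [hammingNorm, Finset.eq_univ_iff_forall] using
    Finset.card_eq_iff_eq_univ (univ.filter fun i => y i ≠ 0)

lemma card_filter_eq_add_hammingNorm (y : ι → F) (α : F) :
    (univ.filter fun i => y i = α).card + hammingNorm (y - fun _ => α) = Fintype.card ι := by
  rw [hammingNorm, ← Finset.card_univ,
    ← Finset.card_filter_add_card_filter_not (s := univ) (p := fun i => y i = α)]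
  simp [sub_eq_zero]

lemma hammingNorm_eq_or_of_isCompletelyRegular {C : Submodule F (ι → F)}
    (hC : IsCompletelyRegular (C : Set (ι → F)))
    (hr : coveringRadius (C : Set (ι → F)) = 2) {v y₀ : ι → F}
    (hv : v ∈ dualWords C) (hv0 : v ≠ 0) (hy₀ : y₀ ∈ dualWords C) (hy₀0 : y₀ ≠ 0)
    (hne : hammingNorm y₀ ≠ hammingNorm v) {y : ι → F} (hy : y ∈ dualWords C) (hy0 : y ≠ 0) :
    hammingNorm y = hammingNorm v ∨ hammingNorm y = hammingNorm y₀ := by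
  classical
  obtain ⟨p, r, h⟩ := exists_quadratic_of_isCompletelyRegular hC hr
  have h1 := h v hv hv0
  have h2 := h y₀ hy₀ hy₀0
  have h3 := h y hy hy0
  by_cases hyv : hammingEigenvalue y = hammingEigenvalue v
  · exact Or.inl (hammingEigenvalue_injOn hyv)
  · right
    have hyv₀ := mt hammingEigenvalue_injOn hne
    refine hammingEigenvalue_injOn ?_
    have e1 : hammingEigenvalue y + hammingEigenvalue v + p = 0 :=
      mul_left_cancel₀ (sub_ne_zero.2 hyv) (by linear_combination h3 - h1)
    have e2 : hammingEigenvalue y₀ + hammingEigenvalue v + p = 0 :=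
      mul_left_cancel₀ (sub_ne_zero.2 hyv₀) (by linear_combination h2 - h1)
    linarith

lemma hammingNorm_eq_minDist_of_isEquidistant {E : Submodule F (ι → F)}
    (hE : IsEquidistant (E : Set (ι → F))) {y : ι → F} (hy : y ∈ E) (hy0 : y ≠ 0) :
    hammingNorm y = minDist (E : Set (ι → F)) := by
  obtain ⟨d, hd⟩ := hE
  have hyd := hd y hy 0 E.zero_mem hy0
  have hset : {d : ℕ | ∃ x ∈ (E : Set (ι → F)), ∃ z ∈ (E : Set (ι → F)),
      x ≠ z ∧ hammingDist x z = d} = {d} := by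
    ext e
    constructor
    · rintro ⟨x, hx, z, hz, hxz, rfl⟩
      exact hd x hx z hz hxz
    · rintro rfl
      exact ⟨y, hy, 0, E.zero_mem, hy0, hyd⟩
  rw [minDist, hset, csInf_singleton, ← hyd, hammingDist_zero_right]

lemma isEquidistant_of_hammingNorm_eq {E : Submodule F (ι → F)} {w : ℕ}
    (hE : ∀ y ∈ E, y ≠ 0 → hammingNorm y = w) : IsEquidistant (E : Set (ι → F)) :=
  ⟨w, fun x hx z hz hxz => by
    rw [hammingDist_eq_hammingNorm]
    exact hE _ (E.add_mem (E.neg_mem hx) hz) (by rwa [neg_add_eq_sub, sub_ne_zero, ne_comm])⟩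

lemma hammingNorm_comp_mul {κ : Type*} [Fintype κ] (e : ι ≃ κ) (s : ι → Fˣ) (y : κ → F) :
    hammingNorm (fun i => (s i : F) * y (e i)) = hammingNorm y := by
  simp only [hammingNorm, ne_eq, mul_eq_zero, Units.ne_zero, false_or]
  exact Finset.card_equiv e (by simp)

lemma mem_dualWords_image_iff {κ : Type*} [Fintype κ] {C : Submodule F (ι → F)}
    {C₀ : Submodule F (κ → F)} {e : ι ≃ κ} {s : ι → Fˣ}
    (h : (fun (x : ι → F) (j : κ) => (s (e.symm j) : F) * x (e.symm j)) '' (C : Set (ι → F)) =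
      (C₀ : Set (κ → F))) {y : κ → F} :
    y ∈ dualWords C₀ ↔ (fun i => (s i : F) * y (e i)) ∈ dualWords C := by
  have hdot : ∀ x : ι → F, (fun j => (s (e.symm j) : F) * x (e.symm j)) ⬝ᵥ y =
      x ⬝ᵥ fun i => (s i : F) * y (e i) := fun x =>
    Fintype.sum_equiv e.symm _ _ fun j => by simp; ring
  simp only [mem_dualWords, ← SetLike.mem_coe (p := C₀), ← h, Set.forall_mem_image, hdot,
    SetLike.mem_coe]

lemma coe_dualWords (C : Submodule F (ι → F)) :
    (dualWords C : Set (ι → F)) = dualSet (C : Set (ι → F)) := by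
  simp [dualWords]

lemma isAntipodal_dualSet_iff {C : Submodule F (ι → F)} :
    IsAntipodal (dualSet (C : Set (ι → F))) ↔ ∃ v ∈ dualWords C, ∀ i, v i ≠ 0 := by
  simp only [IsAntipodal, ← coe_dualWords, Finset.mem_coe, hammingNorm_eq_card_iff]

/-- If the dual of `C` contains the all-one word and its nonzero words have full weight or
weight `w`, then it is spanned by the all-one word and an equidistant code whose nonzero words
take each of their values equally often. -/
lemma exists_equidistant_subcode {C : Submodule F (ι → F)} {w : ℕ}
    (hone : (fun _ => 1) ∈ dualWords C)
    (hwt : ∀ y ∈ dualWords C, y ≠ 0 → hammingNorm y = Fintype.card ι ∨ hammingNorm y = w)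
    (j : ι) (hex : ∃ y ∈ dualWords C, y ≠ 0 ∧ y j = 0) :
    ∃ E : Submodule F (ι → F),
      dualSet (C : Set (ι → F)) =
        (Submodule.span F ({fun _ => (1 : F)} ∪ (E : Set (ι → F))) : Submodule F (ι → F)) ∧
      IsEquidistant (E : Set (ι → F)) ∧
      ∀ v ∈ E, v ≠ (0 : ι → F) → ∀ α : F,
        (univ.filter fun i : ι => v i = α).card =
            Fintype.card ι - minDist (E : Set (ι → F)) ∨
        (univ.filter fun i : ι => v i = α).card = 0 := by
  let E : Submodule F (ι → F) :=
    { carrier := {y | y ∈ dualWords C ∧ y j = 0}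
      add_mem' := fun ha hb => ⟨add_mem_dualWords ha.1 hb.1, by simp [ha.2, hb.2]⟩
      zero_mem' := ⟨zero_mem_dualWords C, rfl⟩
      smul_mem' := fun a y hy => ⟨smul_mem_dualWords a hy.1, by simp [hy.2]⟩ }
  have hsub : ∀ y ∈ dualWords C, ∀ α : F, (y - fun _ => α) ∈ dualWords C := fun y hy α => by
    have : (y - fun _ => α) = y + (-α) • fun _ => (1 : F) := by
      ext i; simp [sub_eq_add_neg]
    rw [this]
    exact add_mem_dualWords hy (smul_mem_dualWords _ hone)
  have hEw : ∀ y ∈ E, y ≠ 0 → hammingNorm y = w := fun y hy hy0 =>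
    (hwt y hy.1 hy0).resolve_left fun h => hammingNorm_eq_card_iff.1 h j hy.2
  have hEeq := isEquidistant_of_hammingNorm_eq hEw
  obtain ⟨y₀, hy₀, hy₀0, hy₀j⟩ := hex
  have hmin : minDist (E : Set (ι → F)) = w := by
    rw [← hammingNorm_eq_minDist_of_isEquidistant hEeq (y := y₀) ⟨hy₀, hy₀j⟩ hy₀0]
    exact hEw y₀ ⟨hy₀, hy₀j⟩ hy₀0
  refine ⟨E, Set.Subset.antisymm ?_ ?_, hEeq, ?_⟩
  · intro y hy
    rw [← coe_dualWords, Finset.mem_coe] at hy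
    have hy' : y = (y - fun _ => y j) + (y j) • fun _ => (1 : F) := by
      ext i; simp
    rw [hy']
    refine Submodule.add_mem _ (Submodule.subset_span (Or.inr ⟨hsub y hy _, by simp⟩))
      (Submodule.smul_mem _ _ (Submodule.subset_span (Or.inl rfl)))
  · intro y hy
    rw [← coe_dualWords, Finset.mem_coe]
    refine Submodule.span_induction ?_ (zero_mem_dualWords C)
      (fun _ _ _ _ => add_mem_dualWords) (fun a _ _ => smul_mem_dualWords a) hy
    rintro z (rfl | hz)
    · exact hone
    · exact hz.1
  · intro y hy hy0 α
    have hcount := card_filter_eq_add_hammingNorm y α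
    have hne : (y - fun _ => α) ≠ 0 := by
      intro h
      have hα : y = fun _ => α := sub_eq_zero.1 h
      have : α = 0 := by rw [← hy.2, hα]
      exact hy0 (by rw [hα, this]; rfl)
    rw [hmin]
    rcases hwt _ (hsub y hy.1 α) hne with h | h <;> omega

lemma hammingNorm_eq_or_of_mem_span {E : Submodule F (ι → F)}
    (hE : IsEquidistant (E : Set (ι → F)))
    (hcount : ∀ v ∈ E, v ≠ (0 : ι → F) → ∀ α : F,
        (univ.filter fun i : ι => v i = α).card =
            Fintype.card ι - minDist (E : Set (ι → F)) ∨
        (univ.filter fun i : ι => v i = α).card = 0)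
    {y : ι → F} (hy : y ∈ Submodule.span F ({fun _ => (1 : F)} ∪ (E : Set (ι → F))))
    (hy0 : y ≠ 0) :
    hammingNorm y = Fintype.card ι ∨
      (∃ z ∈ E, z ≠ 0) ∧ hammingNorm y = minDist (E : Set (ι → F)) := by
  rw [Submodule.span_union, Submodule.span_eq, Submodule.mem_sup] at hy
  obtain ⟨u, hu, z, hz, rfl⟩ := hy
  obtain ⟨a, rfl⟩ := Submodule.mem_span_singleton.1 hu
  by_cases hz0 : z = 0
  · subst hz0
    refine Or.inl (hammingNorm_eq_card_iff.2 fun i hi => hy0 ?_)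
    have : a = 0 := by simpa using hi
    simp [this]
  · have hsum := card_filter_eq_add_hammingNorm z (-a)
    have heq : (z - fun _ => -a) = (a • fun _ => (1 : F)) + z := by
      ext i; simp [add_comm]
    rw [heq] at hsum
    have hle : minDist (E : Set (ι → F)) ≤ Fintype.card ι :=
      hammingNorm_eq_minDist_of_isEquidistant hE hz hz0 ▸ hammingNorm_le_card_fintype
    rcases hcount z hz hz0 (-a) with h | h
    · exact Or.inr ⟨⟨z, hz, hz0⟩, by omega⟩
    · exact Or.inl (by omega)

lemma isCompletelyRegular_of_span_dual {C C₀ : Submodule F (ι → F)}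
    (hfin : Module.finrank F C + 2 ≤ Fintype.card ι)
    (hCC₀ : MonomiallyEquivalent (C : Set (ι → F)) (C₀ : Set (ι → F)))
    {E : Submodule F (ι → F)}
    (hspan : dualSet (C₀ : Set (ι → F)) =
      (Submodule.span F ({fun _ => (1 : F)} ∪ (E : Set (ι → F))) : Submodule F (ι → F)))
    (hE : IsEquidistant (E : Set (ι → F)))
    (hcount : ∀ v ∈ E, v ≠ (0 : ι → F) → ∀ α : F,
        (univ.filter fun i : ι => v i = α).card =
            Fintype.card ι - minDist (E : Set (ι → F)) ∨
        (univ.filter fun i : ι => v i = α).card = 0) :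
    IsCompletelyRegular (C : Set (ι → F)) ∧ coveringRadius (C : Set (ι → F)) = 2 ∧
      IsAntipodal (dualSet (C : Set (ι → F))) := by
  classical
  obtain ⟨e, s, hes⟩ := hCC₀
  have hmem : ∀ {y : ι → F}, y ∈ dualWords C₀ ↔
      y ∈ Submodule.span F ({fun _ => (1 : F)} ∪ (E : Set (ι → F))) := fun {y} => by
    rw [← SetLike.mem_coe (p := Submodule.span F _), ← hspan, ← coe_dualWords, Finset.mem_coe]
  have hwt : ∀ y ∈ dualWords C, y ≠ 0 → hammingNorm y = Fintype.card ι ∨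
      (∃ z ∈ E, z ≠ 0) ∧ hammingNorm y = minDist (E : Set (ι → F)) := by
    intro y hy hy0
    let y' : ι → F := fun j => ((s (e.symm j))⁻¹ : Fˣ) * y (e.symm j)
    have hy' : (fun i => (s i : F) * y' (e i)) = y := by ext i; simp [y']
    have hnorm : hammingNorm y' = hammingNorm y := by
      rw [← hammingNorm_comp_mul e s y', hy']
    rw [← hnorm]
    refine hammingNorm_eq_or_of_mem_span hE hcount
      (hmem.1 ((mem_dualWords_image_iff hes).2 (by rwa [hy']))) ?_
    rw [← hammingNorm_pos_iff, hnorm, hammingNorm_pos_iff]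
    exact hy0
  have hv : (fun i => (s i : F)) ∈ dualWords C := by
    simpa using (mem_dualWords_image_iff hes (y := fun _ => 1)).1
      (hmem.2 (Submodule.subset_span (Or.inl rfl)))
  have hι : 0 < Fintype.card ι := by omega
  obtain ⟨j⟩ := Fintype.card_pos_iff.1 hι
  obtain ⟨y₀, hy₀, hy₀0, hy₀j⟩ := exists_dual_word_apply_eq_zero hfin j
  obtain ⟨z, hz, hz0⟩ := ((hwt y₀ hy₀ hy₀0).resolve_left
    fun h => hammingNorm_eq_card_iff.1 h j hy₀j).1
  have hw : 0 < minDist (E : Set (ι → F)) := by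
    rw [← hammingNorm_eq_minDist_of_isEquidistant hE hz hz0]
    exact hammingNorm_pos_iff.2 hz0
  obtain ⟨i, hi⟩ := Function.ne_iff.1 hy₀0
  have hne : ∃ x, x ∉ C ∧ x ⬝ᵥ (fun i => (s i : F)) = 0 := by
    refine ⟨Pi.single i ((s i)⁻¹ : Fˣ).val - Pi.single j ((s j)⁻¹ : Fˣ).val, fun hx => ?_, ?_⟩
    · have := mem_dualWords.1 hy₀ _ hx
      rw [sub_dotProduct, single_dotProduct, single_dotProduct, hy₀j, mul_zero, sub_zero] at this
      exact mul_ne_zero (Units.ne_zero _) hi this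
    · rw [sub_dotProduct, single_dotProduct, single_dotProduct]
      simp
  obtain ⟨h1, h2⟩ := isCompletelyRegular_of_two_weights hw
    (fun y hy hy0 => (hwt y hy hy0).imp_right And.right) hv (fun i => (s i).ne_zero) hne
  exact ⟨h1, h2, isAntipodal_dualSet_iff.2 ⟨_, hv, fun i => (s i).ne_zero⟩⟩

end Weights

lemma exists_extendedCode {m : ℕ} {C : Submodule F (Fin (m + 1) → F)} {v : Fin (m + 1) → F}
    {w : ℕ} (hv : v ∈ dualWords C) (hv0 : ∀ i, v i ≠ 0)
    (hwt : ∀ y ∈ dualWords C, y ≠ 0 → hammingNorm y = m + 1 ∨ hammingNorm y = w)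
    (hex : ∃ y ∈ dualWords C, y ≠ 0 ∧ y (Fin.last m) = 0) :
    ∃ D : Submodule F (Fin m → F),
      IsCompletelyRegular (D : Set (Fin m → F)) ∧
      coveringRadius (D : Set (Fin m → F)) = 1 ∧
      MonomiallyEquivalent (C : Set (Fin (m + 1) → F)) (extendedCode (D : Set (Fin m → F))) := by
  let f : (Fin (m + 1) → F) →ₗ[F] (Fin m → F) :=
    { toFun := fun x i => v i.castSucc * x i.castSucc
      map_add' := fun x y => by ext i; simp [mul_add]
      map_smul' := fun a x => by ext i; simp; ring }
  have hf : ∀ x i, f x i = v i.castSucc * x i.castSucc := fun _ _ => rfl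
  have hlast : ∀ y ∈ dualWords C, y ≠ 0 → y (Fin.last m) = 0 → hammingNorm y = w :=
    fun y hy hy0 hyl => (hwt y hy hy0).resolve_left fun h =>
      hammingNorm_eq_card_iff.1 (h.trans (Fintype.card_fin _).symm) _ hyl
  have hnorm : ∀ y : Fin m → F,
      hammingNorm (Fin.snoc (fun i => v i.castSucc * y i) 0 : Fin (m + 1) → F) =
        hammingNorm y := by
    intro y
    simp only [hammingNorm, Finset.card_filter, Fin.sum_univ_castSucc, Fin.snoc_castSucc,
      Fin.snoc_last]
    simp [hv0]
  obtain ⟨y₀, hy₀, hy₀0, hy₀l⟩ := hex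
  have hreg : IsCompletelyRegular (C.map f : Set (Fin m → F)) ∧
      coveringRadius (C.map f : Set (Fin m → F)) = 1 := by
    refine isCompletelyRegular_of_one_weight (w := w) ?_ ?_ ?_
    · rw [← hlast y₀ hy₀ hy₀0 hy₀l]
      exact hammingNorm_pos_iff.2 hy₀0
    · intro y hy hy0
      rw [← hnorm y]
      refine hlast _ ?_ ?_ (by simp)
      · rw [mem_dualWords] at hy ⊢
        intro x hx
        refine Eq.trans ?_ (hy (f x) ⟨x, hx, rfl⟩)
        rw [dotProduct, dotProduct, Fin.sum_univ_castSucc]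
        simp only [Fin.snoc_castSucc, Fin.snoc_last, mul_zero, add_zero, hf]
        exact Finset.sum_congr rfl fun i _ => by ring
      · rwa [← hammingNorm_pos_iff, hnorm, hammingNorm_pos_iff]
    · obtain ⟨i, hi⟩ := Function.ne_iff.1 hy₀0
      obtain ⟨i, rfl⟩ : ∃ i' : Fin m, i = i'.castSucc :=
        (Fin.exists_castSucc_eq.2 fun h => hi (by rw [h, hy₀l]; rfl)).imp fun _ h => h.symm
      refine ⟨Pi.single i 1, ?_⟩
      rintro ⟨x, hx, hxi⟩
      have hcoord : ∀ k : Fin m,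
        v k.castSucc * x k.castSucc = (Pi.single i (1 : F) : Fin m → F) k :=
        fun k => congrFun hxi k
      have h0 := mem_dualWords.1 hy₀ x hx
      rw [dotProduct, Fin.sum_univ_castSucc, hy₀l, mul_zero, add_zero,
        Finset.sum_eq_single i] at h0
      · have hxi0 : x i.castSucc ≠ 0 := fun h => by
          have := hcoord i
          simp [h] at this
        exact mul_ne_zero hxi0 hi h0
      · intro k _ hk
        have := hcoord k
        rw [Pi.single_eq_of_ne hk] at this
        rw [(mul_eq_zero.1 this).resolve_left (hv0 _), zero_mul]
      · simp
  obtain ⟨hD, hr⟩ := hreg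
  refine ⟨C.map f, hD, hr, Equiv.refl _, fun i => Units.mk0 (v i) (hv0 i), ?_⟩
  ext z
  constructor
  · rintro ⟨x, hx, rfl⟩
    refine ⟨⟨x, hx, rfl⟩, ?_⟩
    have := mem_dualWords.1 hv x hx
    rw [dotProduct_comm] at this
    exact this
  · rintro ⟨⟨x, hx, hxz⟩, hz⟩
    refine ⟨x, hx, funext fun i => ?_⟩
    have hcast : ∀ i : Fin m, v i.castSucc * x i.castSucc = z i.castSucc :=
      fun i => congrFun hxz i
    refine Fin.lastCases ?_ (fun i => hcast i) i
    have := mem_dualWords.1 hv x hx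
    rw [dotProduct_comm, dotProduct, Fin.sum_univ_castSucc] at this
    rw [Fin.sum_univ_castSucc, ← Finset.sum_congr rfl fun i _ => hcast i, ← this] at hz
    exact (add_left_cancel hz).symm

/-- a nontrivial linear code is completely regular with covering radius 2 and
antipodal dual iff (up to monomial equivalence) its dual is spanned by the all-one vector
together with an equidistant subcode `E` in which every symbol occurring in a nonzero codeword
occurs exactly `n - d̃` times; moreover such a code is monomially equivalent to the extension
of a completely regular code with covering radius 1. -/
theorem completely_regular_rho_two_antipodal_dual
    {F : Type*} [Field F] [Fintype F] [DecidableEq F] {n k d : ℕ}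
    (C : Submodule F (Fin n → F))
    (hk : Module.finrank F C = k)
    (hd : minDist (C : Set (Fin n → F)) = d)
    (hk2 : 2 ≤ k) (hkn : k + 2 ≤ n) :
    ((IsCompletelyRegular (C : Set (Fin n → F)) ∧
        coveringRadius (C : Set (Fin n → F)) = 2 ∧
        IsAntipodal (dualSet (C : Set (Fin n → F)))) ↔
      ∃ C₀ : Submodule F (Fin n → F),
        MonomiallyEquivalent (C : Set (Fin n → F)) (C₀ : Set (Fin n → F)) ∧
        ∃ E : Submodule F (Fin n → F),
          dualSet (C₀ : Set (Fin n → F)) =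
            (Submodule.span F ({fun _ => (1 : F)} ∪ (E : Set (Fin n → F))) :
              Submodule F (Fin n → F)) ∧
          IsEquidistant (E : Set (Fin n → F)) ∧
          ∀ v ∈ E, v ≠ (0 : Fin n → F) → ∀ α : F,
            (Finset.univ.filter fun i : Fin n => v i = α).card =
                n - minDist (E : Set (Fin n → F)) ∨
            (Finset.univ.filter fun i : Fin n => v i = α).card = 0) ∧
    ((IsCompletelyRegular (C : Set (Fin n → F)) ∧
        coveringRadius (C : Set (Fin n → F)) = 2 ∧
        IsAntipodal (dualSet (C : Set (Fin n → F)))) →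
      ∃ D : Submodule F (Fin (n - 1) → F),
        IsCompletelyRegular (D : Set (Fin (n - 1) → F)) ∧
        coveringRadius (D : Set (Fin (n - 1) → F)) = 1 ∧
        MonomiallyEquivalent (C : Set (Fin n → F))
          (extendedCode (D : Set (Fin (n - 1) → F)))) := by
  subst hk
  obtain ⟨m, rfl⟩ : ∃ m, n = m + 1 := ⟨n - 1, by omega⟩
  have hfin : Module.finrank F C + 2 ≤ Fintype.card (Fin (m + 1)) := by simpa using hkn
  have hex := exists_dual_word_apply_eq_zero hfin (Fin.last m)
  have hweights : IsCompletelyRegular (C : Set (Fin (m + 1) → F)) ∧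
      coveringRadius (C : Set (Fin (m + 1) → F)) = 2 ∧
      IsAntipodal (dualSet (C : Set (Fin (m + 1) → F))) →
      ∃ v ∈ dualWords C, (∀ i, v i ≠ 0) ∧ ∃ w, ∀ y ∈ dualWords C, y ≠ 0 →
        hammingNorm y = m + 1 ∨ hammingNorm y = w := by
    rintro ⟨hC, hr, ha⟩
    obtain ⟨v, hv, hv0⟩ := isAntipodal_dualSet_iff.1 ha
    obtain ⟨y₀, hy₀, hy₀0, hy₀l⟩ := hex
    have hvn := hammingNorm_eq_card_iff.2 hv0
    refine ⟨v, hv, hv0, hammingNorm y₀, fun y hy hy0 => ?_⟩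
    rw [Fintype.card_fin] at hvn
    refine (hammingNorm_eq_or_of_isCompletelyRegular hC hr hv
      (fun h => hv0 (Fin.last m) (by rw [h]; rfl)) hy₀ hy₀0 (fun h => ?_) hy hy0).imp_left
        fun h => h.trans hvn
    exact hammingNorm_eq_card_iff.1 (h.trans (hammingNorm_eq_card_iff.2 hv0)) _ hy₀l
  refine ⟨⟨fun h => ?_, ?_⟩, fun h => ?_⟩
  · obtain ⟨v, hv, hv0, w, hwt⟩ := hweights h
    let s : Fin (m + 1) → Fˣ := fun i => Units.mk0 (v i) (hv0 i)
    let f : (Fin (m + 1) → F) →ₗ[F] (Fin (m + 1) → F) :=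
      { toFun := fun x i => (s i : F) * x i
        map_add' := fun x y => by ext i; simp [mul_add]
        map_smul' := fun a x => by ext i; simp; ring }
    have himage : (fun (x : Fin (m + 1) → F) (j : Fin (m + 1)) =>
        (s ((Equiv.refl _).symm j) : F) * x ((Equiv.refl _).symm j)) ''
          (C : Set (Fin (m + 1) → F)) = (C.map f : Set (Fin (m + 1) → F)) := rfl
    have hmem := fun y => mem_dualWords_image_iff himage (y := y)
    have hnorm := hammingNorm_comp_mul (Equiv.refl (Fin (m + 1))) s
    obtain ⟨E, hE⟩ := exists_equidistant_subcode (C := C.map f) (w := w)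
      ((hmem _).2 (by simpa [s] using hv))
      (fun y hy hy0 => by
        rw [← hnorm y, Fintype.card_fin]
        refine hwt _ ((hmem y).1 hy) ?_
        rwa [← hammingNorm_pos_iff, hnorm, hammingNorm_pos_iff])
      (Fin.last m) (by
        obtain ⟨y, hy, hy0, hyl⟩ := hex
        refine ⟨fun i => ((s i)⁻¹ : Fˣ) * y i, (hmem _).2 ?_, ?_, by simp [hyl]⟩
        · simpa using hy
        · obtain ⟨i, hi⟩ := Function.ne_iff.1 hy0
          exact Function.ne_iff.2 ⟨i, mul_ne_zero (Units.ne_zero _) hi⟩)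
    simp only [Fintype.card_fin] at hE
    exact ⟨C.map f, ⟨Equiv.refl _, s, himage⟩, E, hE⟩
  · rintro ⟨C₀, hCC₀, E, hspan, hE, hcount⟩
    exact isCompletelyRegular_of_span_dual hfin hCC₀ hspan hE (by simpa using hcount)
  · obtain ⟨v, hv, hv0, w, hwt⟩ := hweights h
    exact exists_extendedCode hv hv0 hwt hex
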